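/- Let σ > 4 be an integer and a, b, c three vector fields with a ∈ H^σ(ℝ³) ∩ C^{σ+1/4}(ℝ³), b ∈ H^{σ+1}(ℝ³) ∩ C^{σ+5/4}(ℝ³), c ∈ H^σ(ℝ³), and div a = 0. Then there exists a constant C(σ) such that |⟨a·∇b, c⟩_{H^σ}| ≤ C(σ) ‖c‖_{H^σ} min( ‖a‖_{C^{σ+1/4}} ‖∇b‖_{H^σ}, ‖a‖_{H^σ} ‖b‖_{C^{σ+5/4}} ). -/

import Mathlib

open MeasureTheory Real Topology Filter Set
open scoped ENNReal NNReal

noncomputable section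

/-- Vector in `ℝ³`. -/
abbrev V3 := Fin 3 → ℝ

/-- The third basis vector `e₃`. -/
def e3 : V3 := ![0, 0, 1]

/-- Cross product in `ℝ³`. -/
def cross (a b : V3) : V3 :=
  ![a 1 * b 2 - a 2 * b 1, a 2 * b 0 - a 0 * b 2, a 0 * b 1 - a 1 * b 0]

/-- Partial derivative `∂ᵢ f`. -/
def pd (i : Fin 3) (f : V3 → ℝ) (x : V3) : ℝ := fderiv ℝ f x (Pi.single i 1)

/-- Iterated partial derivative `∂^α f`, for a multi-index given as a word `α : Fin k → Fin 3`. -/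
def mder : (k : ℕ) → (Fin k → Fin 3) → (V3 → ℝ) → (V3 → ℝ)
  | 0, _, f => f
  | k + 1, α, f => mder k (Fin.tail α) (pd (α 0) f)

/-- `H^σ` inner product of scalar functions: `∑_{|α| ≤ σ} ∫ ∂^α f ∂^α g`. -/
def sobInner (σ : ℕ) (f g : V3 → ℝ) : ℝ :=
  ∑ k ∈ Finset.range (σ + 1), ∑ α : Fin k → Fin 3, ∫ x : V3, mder k α f x * mder k α g x

/-- `H^σ` inner product of vector fields. -/
def sobInnerV (σ : ℕ) (u v : V3 → V3) : ℝ :=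
  ∑ j : Fin 3, sobInner σ (fun x => u x j) (fun x => v x j)

/-- Square of the `H^σ` norm of a vector field. -/
def sobNormSq (σ : ℕ) (u : V3 → V3) : ℝ := sobInnerV σ u u

/-- `H^σ` norm of a vector field. -/
def sobNorm (σ : ℕ) (u : V3 → V3) : ℝ := Real.sqrt (sobNormSq σ u)

/-- Membership in `H^σ`: `σ` times continuously differentiable with all derivatives up to
order `σ` square integrable. -/
def InSob (σ : ℕ) (f : V3 → ℝ) : Prop :=
  ContDiff ℝ σ f ∧ ∀ k : ℕ, k ≤ σ → ∀ α : Fin k → Fin 3, MemLp (mder k α f) 2 volume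

/-- Membership of a vector field in `H^σ`. -/
def InSobV (σ : ℕ) (u : V3 → V3) : Prop := ∀ j : Fin 3, InSob σ (fun x => u x j)

/-- Divergence of a vector field. -/
def vdiv (u : V3 → V3) (x : V3) : ℝ := ∑ i : Fin 3, pd i (fun y => u y i) x

/-- Laplacian of a scalar function. -/
def lap (f : V3 → ℝ) (x : V3) : ℝ := ∑ i : Fin 3, pd i (pd i f) x

/-- Laplacian of a vector field. -/
def lapv (u : V3 → V3) (x : V3) : V3 := fun j => lap (fun y => u y j) x

/-- Advection term `u·∇v`. -/
def advect (u v : V3 → V3) (x : V3) : V3 := fun j => ∑ i : Fin 3, u x i * pd i (fun y => v y j) x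

/-- Curl of a vector field. -/
def curl (u : V3 → V3) (x : V3) : V3 :=
  ![pd 1 (fun y => u y 2) x - pd 2 (fun y => u y 1) x,
    pd 2 (fun y => u y 0) x - pd 0 (fun y => u y 2) x,
    pd 0 (fun y => u y 1) x - pd 1 (fun y => u y 0) x]

/-- Gradient of a scalar function. -/
def grad (p : V3 → ℝ) (x : V3) : V3 := fun i => pd i p x

/-- Square of the `L²` norm of a vector field. -/
def l2NormSq (u : V3 → V3) : ℝ := sobNormSq 0 u

/-- Square of the `H^σ` norm of the gradient `∇u` of a vector field. -/
def gradSobSq (σ : ℕ) (u : V3 → V3) : ℝ :=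
  ∑ i : Fin 3, sobNormSq σ (fun x j => pd i (fun y => u y j) x)

/-- Right-hand side of the velocity equation of `(MHD^ε)`:
`∂ₜu = εΔu - u·∇u + curl b × b - √ε curl b × e₃ - (u × e₃)/ε - ∇p`. -/
def mhdRHSu (ε : ℝ) (u b : ℝ → V3 → V3) (p : ℝ → V3 → ℝ) (t : ℝ) (x : V3) : V3 :=
  ε • lapv (u t) x - advect (u t) (u t) x + cross (curl (b t) x) (b t x)
    - Real.sqrt ε • cross (curl (b t) x) e3 - ε⁻¹ • cross (u t x) e3 - grad (p t) x

/-- Right-hand side of the magnetic field equation of `(MHD^ε)`: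
`∂ₜb = √εΔb - u·∇b + b·∇u - √ε curl (u × e₃)`. -/
def mhdRHSb (ε : ℝ) (u b : ℝ → V3 → V3) (t : ℝ) (x : V3) : V3 :=
  Real.sqrt ε • lapv (b t) x - advect (u t) (b t) x + advect (b t) (u t) x
    - Real.sqrt ε • curl (fun y => cross (u t y) e3) x

/-- `(u, b, p)` is a (pointwise) solution of the system `(MHD^ε)` for times in `S`. -/
def IsMHDOn (ε : ℝ) (S : Set ℝ) (u b : ℝ → V3 → V3) (p : ℝ → V3 → ℝ) : Prop :=
  ∀ t ∈ S, ∀ x : V3,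
    (∀ j : Fin 3, HasDerivAt (fun s => u s x j) (mhdRHSu ε u b p t x j) t) ∧
    (∀ j : Fin 3, HasDerivAt (fun s => b s x j) (mhdRHSb ε u b t x j) t) ∧
    vdiv (u t) x = 0 ∧ vdiv (b t) x = 0

/-- Hölder seminorm of exponent `ρ` (with values in `ℝ≥0∞`). -/
def holderSemi (ρ : ℝ) (f : V3 → ℝ) : ℝ≥0∞ :=
  ⨆ x : V3, ⨆ y : V3, (‖f x - f y‖₊ : ℝ≥0∞) / edist x y ^ ρ

/-- Hölder–Zygmund `C^ρ` norm of a scalar function (with values in `ℝ≥0∞`). -/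
def cNorm (ρ : ℝ) (f : V3 → ℝ) : ℝ≥0∞ :=
  (∑ k ∈ Finset.range (⌊ρ⌋₊ + 1), ∑ α : Fin k → Fin 3, ⨆ x : V3, (‖mder k α f x‖₊ : ℝ≥0∞))
    + ∑ α : Fin ⌊ρ⌋₊ → Fin 3, holderSemi (ρ - ⌊ρ⌋₊) (mder ⌊ρ⌋₊ α f)

/-- Hölder–Zygmund `C^ρ` norm of a vector field. -/
def cNormV (ρ : ℝ) (u : V3 → V3) : ℝ≥0∞ := ∑ j : Fin 3, cNorm ρ (fun x => u x j)

theorem pd_contDiff {n : ℕ} {f : V3 → ℝ} (hf : ContDiff ℝ ((n + 1 : ℕ) : WithTop ℕ∞) f) (i : Fin 3) :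
    ContDiff ℝ (n : WithTop ℕ∞) (pd i f) := by
  unfold pd
  exact (hf.fderiv_right (m := (n : WithTop ℕ∞)) (by push_cast; exact le_rfl)).clm_apply
    contDiff_const

theorem mder_continuous : ∀ (k : ℕ) (α : Fin k → Fin 3) (f : V3 → ℝ),
    ContDiff ℝ (k : WithTop ℕ∞) f → Continuous (mder k α f)
  | 0, _, _, hf => hf.continuous
  | k + 1, α, _, hf => mder_continuous k (Fin.tail α) _ (pd_contDiff hf (α 0))

theorem pd_add {f g : V3 → ℝ} (hf : Differentiable ℝ f) (hg : Differentiable ℝ g) (i : Fin 3) :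
    pd i (fun x => f x + g x) = fun x => pd i f x + pd i g x := by
  funext x
  simp only [pd]
  rw [fderiv_fun_add (hf x) (hg x)]
  rfl

theorem pd_mul {f g : V3 → ℝ} (hf : Differentiable ℝ f) (hg : Differentiable ℝ g) (i : Fin 3) :
    pd i (fun x => f x * g x) = fun x => pd i f x * g x + f x * pd i g x := by
  funext x
  simp only [pd]
  rw [fderiv_fun_mul (hf x) (hg x)]
  simp
  ring

theorem diff_of_succ {k : ℕ} {f : V3 → ℝ} (hf : ContDiff ℝ ((k + 1 : ℕ) : WithTop ℕ∞) f) :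
    Differentiable ℝ f := hf.differentiable (by simp)

theorem contDiff_of_succ {k : ℕ} {f : V3 → ℝ} (hf : ContDiff ℝ ((k + 1 : ℕ) : WithTop ℕ∞) f) :
    ContDiff ℝ (k : WithTop ℕ∞) f := hf.of_le (by exact_mod_cast Nat.le_succ k)

theorem mder_add : ∀ (k : ℕ) (α : Fin k → Fin 3) (f g : V3 → ℝ),
    ContDiff ℝ (k : WithTop ℕ∞) f → ContDiff ℝ (k : WithTop ℕ∞) g →
    mder k α (fun x => f x + g x) = fun x => mder k α f x + mder k α g x
  | 0, _, _, _, _, _ => rfl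
  | k + 1, α, f, g, hf, hg => by
    simp only [mder]
    rw [pd_add (diff_of_succ hf) (diff_of_succ hg)]
    exact mder_add k _ _ _ (pd_contDiff hf _) (pd_contDiff hg _)

theorem eLpNorm_mder_add_le (k : ℕ) (α : Fin k → Fin 3) (f g : V3 → ℝ)
    (hf : ContDiff ℝ (k : WithTop ℕ∞) f) (hg : ContDiff ℝ (k : WithTop ℕ∞) g) :
    eLpNorm (mder k α (fun x => f x + g x)) 2 volume ≤
      eLpNorm (mder k α f) 2 volume + eLpNorm (mder k α g) 2 volume := by
  rw [mder_add k α f g hf hg]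
  exact eLpNorm_add_le (mder_continuous k α f hf).aestronglyMeasurable
    (mder_continuous k α g hg).aestronglyMeasurable (by norm_num)

/-- Leibniz estimate: sup bound on derivatives of `f`, `L²` bound on those of `g`. -/
theorem leibniz (A B : ℝ≥0∞) : ∀ (k : ℕ) (α : Fin k → Fin 3) (f g : V3 → ℝ),
    ContDiff ℝ (k : WithTop ℕ∞) f → ContDiff ℝ (k : WithTop ℕ∞) g →
    (∀ m ≤ k, ∀ β : Fin m → Fin 3, ∀ x, ‖mder m β f x‖ₑ ≤ A) →
    (∀ m ≤ k, ∀ β : Fin m → Fin 3, eLpNorm (mder m β g) 2 volume ≤ B) →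
    eLpNorm (mder k α (fun x => f x * g x)) 2 volume ≤ 2 ^ k * (A * B)
  | 0, α, f, g, hf, hg, hA, hB => by
    simp only [mder, pow_zero, one_mul]
    have h1 : eLpNorm (fun x => f x * g x) 2 volume ≤
        eLpNorm f ⊤ volume * eLpNorm g 2 volume :=
      eLpNorm_smul_le_eLpNorm_top_mul_eLpNorm (p := 2) (f := g)
        hg.continuous.aestronglyMeasurable f
    refine h1.trans (mul_le_mul' ?_ (hB 0 le_rfl α))
    rw [eLpNorm_exponent_top]
    exact eLpNormEssSup_le_of_ae_enorm_bound (ae_of_all _ fun x => hA 0 le_rfl α x)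
  | k + 1, α, f, g, hf, hg, hA, hB => by
    simp only [mder]
    rw [pd_mul (diff_of_succ hf) (diff_of_succ hg)]
    have f' := pd_contDiff hf (α 0)
    have g' := pd_contDiff hg (α 0)
    have f0 := contDiff_of_succ hf
    have g0 := contDiff_of_succ hg
    refine (eLpNorm_mder_add_le k _ _ _ (f'.mul g0) (f0.mul g')).trans ?_
    have e1 := leibniz A B k (Fin.tail α) (pd (α 0) f) g f' g0
      (fun m hm β x => by
        simpa [mder] using hA (m + 1) (by omega) (Fin.cons (α 0) β) x)
      (fun m hm β => hB m (by omega) β)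
    have e2 := leibniz A B k (Fin.tail α) f (pd (α 0) g) f0 g'
      (fun m hm β x => hA m (by omega) β x)
      (fun m hm β => by
        simpa [mder] using hB (m + 1) (by omega) (Fin.cons (α 0) β))
    refine (add_le_add e1 e2).trans (le_of_eq ?_)
    ring

theorem leibniz' (A B : ℝ≥0∞) (k : ℕ) (α : Fin k → Fin 3) (f g : V3 → ℝ)
    (hf : ContDiff ℝ (k : WithTop ℕ∞) f) (hg : ContDiff ℝ (k : WithTop ℕ∞) g)
    (hA : ∀ m ≤ k, ∀ β : Fin m → Fin 3, eLpNorm (mder m β f) 2 volume ≤ A)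
    (hB : ∀ m ≤ k, ∀ β : Fin m → Fin 3, ∀ x, ‖mder m β g x‖ₑ ≤ B) :
    eLpNorm (mder k α (fun x => f x * g x)) 2 volume ≤ 2 ^ k * (A * B) := by
  have h := leibniz B A k α g f hg hf hB hA
  rw [mul_comm B A] at h
  simpa only [mul_comm] using h

theorem sob_term_le {σ : ℕ} {u : V3 → V3} (hu : InSobV σ u) (j : Fin 3) {k : ℕ} (hk : k ≤ σ)
    (α : Fin k → Fin 3) :
    eLpNorm (mder k α (fun x => u x j)) 2 volume ≤ ENNReal.ofReal (sobNorm σ u) := by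
  have hm := (hu j).2 k hk α
  have hnn : ∀ (i : Fin 3) (l : ℕ) (β : Fin l → Fin 3),
      0 ≤ ∫ x : V3, mder l β (fun x => u x i) x * mder l β (fun x => u x i) x :=
    fun i l β => integral_nonneg fun x => mul_self_nonneg _
  have key : ∫ x : V3, mder k α (fun x => u x j) x * mder k α (fun x => u x j) x
      ≤ sobNormSq σ u := by
    unfold sobNormSq sobInnerV sobInner
    refine le_trans ?_ (Finset.single_le_sum (fun i _ => Finset.sum_nonneg fun l _ =>
      Finset.sum_nonneg fun β _ => hnn i l β) (Finset.mem_univ j))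
    refine le_trans ?_ (Finset.single_le_sum (fun l _ =>
      Finset.sum_nonneg fun β _ => hnn j l β) (Finset.mem_range.2 (Nat.lt_succ_of_le hk)))
    exact Finset.single_le_sum (f := fun β : Fin k → Fin 3 =>
      ∫ x : V3, mder k β (fun x => u x j) x * mder k β (fun x => u x j) x)
      (fun β _ => hnn j k β) (Finset.mem_univ α)
  rw [hm.eLpNorm_eq_integral_rpow_norm (by norm_num) (by norm_num)]
  refine ENNReal.ofReal_le_ofReal ?_
  unfold sobNorm
  rw [Real.sqrt_eq_rpow]
  simp only [ENNReal.toReal_ofNat]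
  rw [one_div]
  refine Real.rpow_le_rpow (integral_nonneg fun x => by positivity) ?_ (by norm_num)
  refine le_trans (le_of_eq ?_) key
  refine integral_congr_ae (ae_of_all _ fun x => ?_)
  simp only [Real.rpow_two, Real.norm_eq_abs, sq_abs]
  ring

theorem c_term_le {ρ : ℝ} {n : ℕ} (hn : ⌊ρ⌋₊ = n) (u : V3 → V3) (j : Fin 3) {k : ℕ} (hk : k ≤ n)
    (α : Fin k → Fin 3) (x : V3) :
    ‖mder k α (fun x => u x j) x‖ₑ ≤ cNormV ρ u := by
  subst hn
  unfold cNormV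
  refine le_trans ?_ (Finset.single_le_sum (f := fun j => cNorm ρ (fun x => u x j))
    (fun _ _ => zero_le) (Finset.mem_univ j))
  unfold cNorm
  refine le_trans ?_ le_self_add
  refine le_trans ?_ (Finset.single_le_sum (f := fun k => ∑ α : Fin k → Fin 3,
    ⨆ x : V3, (‖mder k α (fun x => u x j) x‖₊ : ℝ≥0∞))
    (fun _ _ => zero_le) (Finset.mem_range.2 (Nat.lt_succ_of_le hk)))
  refine le_trans ?_ (Finset.single_le_sum (f := fun α : Fin k → Fin 3 =>
    ⨆ x : V3, (‖mder k α (fun x => u x j) x‖₊ : ℝ≥0∞))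
    (fun _ _ => zero_le) (Finset.mem_univ α))
  exact le_iSup (fun x => (‖mder k α (fun x => u x j) x‖₊ : ℝ≥0∞)) x

theorem enorm_integral_mul_le {f g : V3 → ℝ} (hf : Continuous f) (hg : Continuous g) :
    ‖∫ x, f x * g x‖ₑ ≤ eLpNorm f 2 volume * eLpNorm g 2 volume := by
  refine (enorm_integral_le_lintegral_enorm _).trans ?_
  rw [← eLpNorm_one_eq_lintegral_enorm]
  have h := eLpNorm_smul_le_mul_eLpNorm (p := 2) (q := 2) (r := 1) (μ := (volume : Measure V3))
    (f := g) (φ := f) hg.aestronglyMeasurable hf.aestronglyMeasurable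
  exact h

theorem sobNormSq_nonneg (σ : ℕ) (u : V3 → V3) : 0 ≤ sobNormSq σ u := by
  unfold sobNormSq sobInnerV sobInner
  exact Finset.sum_nonneg fun _ _ => Finset.sum_nonneg fun _ _ => Finset.sum_nonneg fun _ _ =>
    integral_nonneg fun _ => mul_self_nonneg _

theorem advect_term_le {σ : ℕ} (a b c : V3 → V3) (ha : InSobV σ a) (hb : InSobV (σ + 1) b)
    (hc : InSobV σ c) (j : Fin 3) {k : ℕ} (hk : k ≤ σ) (α : Fin k → Fin 3) (M : ℝ≥0∞)
    (hM : ∀ i, eLpNorm (mder k α (fun x => a x i * pd i (fun y => b y j) x)) 2 volume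
      ≤ 2 ^ k * M) :
    ‖∫ x, mder k α (fun x => advect a b x j) x * mder k α (fun x => c x j) x‖ₑ
      ≤ 3 * 2 ^ σ * (ENNReal.ofReal (sobNorm σ c) * M) := by
  have hkσ : (k : WithTop ℕ∞) ≤ (σ : WithTop ℕ∞) := by exact_mod_cast hk
  have hprod : ∀ i, ContDiff ℝ (k : WithTop ℕ∞) (fun x => a x i * pd i (fun y => b y j) x) :=
    fun i => ((ha i).1.of_le hkσ).mul ((pd_contDiff (hb j).1 i).of_le hkσ)
  have hadv : (fun x => advect a b x j) = fun x =>
      (a x 0 * pd 0 (fun y => b y j) x + a x 1 * pd 1 (fun y => b y j) x)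
        + a x 2 * pd 2 (fun y => b y j) x := by
    funext x
    simp only [advect, Fin.sum_univ_three]
  have h01 := (hprod 0).add (hprod 1)
  have hcd : ContDiff ℝ (k : WithTop ℕ∞) (fun x => advect a b x j) := by
    rw [hadv]; exact h01.add (hprod 2)
  refine (enorm_integral_mul_le (mder_continuous k α _ hcd)
    (mder_continuous k α _ ((hc j).1.of_le hkσ))).trans ?_
  have h1 : eLpNorm (mder k α (fun x => advect a b x j)) 2 volume ≤ 3 * 2 ^ σ * M := by
    rw [hadv]
    refine (eLpNorm_mder_add_le k α _ _ h01 (hprod 2)).trans ?_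
    refine (add_le_add ((eLpNorm_mder_add_le k α _ _ (hprod 0) (hprod 1)).trans
      (add_le_add (hM 0) (hM 1))) (hM 2)).trans ?_
    have h2 : (2 : ℝ≥0∞) ^ k ≤ 2 ^ σ := pow_le_pow_right₀ (by norm_num) hk
    calc 2 ^ k * M + 2 ^ k * M + 2 ^ k * M = 3 * 2 ^ k * M := by ring
      _ ≤ 3 * 2 ^ σ * M := by gcongr
  refine (mul_le_mul' h1 (sob_term_le hc j hk α)).trans (le_of_eq ?_)
  ring

theorem final_bound {σ : ℕ} (a b c : V3 → V3) (ha : InSobV σ a) (hb : InSobV (σ + 1) b)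
    (hc : InSobV σ c) (M : ℝ) (hM0 : 0 ≤ M)
    (hM : ∀ i j, ∀ k ≤ σ, ∀ α : Fin k → Fin 3,
      eLpNorm (mder k α (fun x => a x i * pd i (fun y => b y j) x)) 2 volume
      ≤ 2 ^ k * ENNReal.ofReal M) :
    |sobInnerV σ (fun x => advect a b x) c| ≤
      (∑ _j : Fin 3, ∑ k ∈ Finset.range (σ + 1), ∑ _α : Fin k → Fin 3, (3 * 2 ^ σ : ℝ))
        * (sobNorm σ c * M) := by
  unfold sobInnerV sobInner
  rw [Finset.sum_mul]
  refine (Finset.abs_sum_le_sum_abs _ _).trans (Finset.sum_le_sum fun j _ => ?_)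
  rw [Finset.sum_mul]
  refine (Finset.abs_sum_le_sum_abs _ _).trans (Finset.sum_le_sum fun k hk => ?_)
  rw [Finset.sum_mul]
  refine (Finset.abs_sum_le_sum_abs _ _).trans (Finset.sum_le_sum fun α _ => ?_)
  have hk' : k ≤ σ := Nat.le_of_lt_succ (Finset.mem_range.1 hk)
  have h := advect_term_le a b c ha hb hc j hk' α _ (fun i => hM i j k hk' α)
  have hs : 0 ≤ sobNorm σ c := Real.sqrt_nonneg _
  rw [← ENNReal.ofReal_mul hs] at h
  have h3 : (3 * 2 ^ σ : ℝ≥0∞) = ENNReal.ofReal (3 * 2 ^ σ) := by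
    rw [ENNReal.ofReal_mul (by norm_num), ENNReal.ofReal_pow (by norm_num)]
    norm_num
  rw [h3, ← ENNReal.ofReal_mul (by positivity), Real.enorm_eq_ofReal_abs] at h
  exact (ENNReal.ofReal_le_ofReal_iff (by positivity)).1 h

theorem InSobV.pd {σ : ℕ} {b : V3 → V3} (hb : InSobV (σ + 1) b) (i : Fin 3) :
    InSobV σ (fun x j => pd i (fun y => b y j) x) := fun j =>
  ⟨pd_contDiff (hb j).1 i, fun k hk α => by
    simpa [mder] using (hb j).2 (k + 1) (by omega) (Fin.cons i α)⟩

/-- Lemma 7 of the paper. Let `σ > 4` be an integer and let `a, b, c` be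
vector fields with `a ∈ H^σ(ℝ³) ∩ C^{σ+1/4}(ℝ³)`, `b ∈ H^{σ+1}(ℝ³) ∩ C^{σ+5/4}(ℝ³)`,
`c ∈ H^σ(ℝ³)` and `div a = 0`. Then there is a constant `C(σ)` with
`|⟨a·∇b, c⟩_{H^σ}| ≤ C(σ)‖c‖_{H^σ} min(‖a‖_{C^{σ+1/4}}‖∇b‖_{H^σ}, ‖a‖_{H^σ}‖b‖_{C^{σ+5/4}})`. -/
theorem product_law_Hs_Holder (σ : ℕ) (hσ : 4 < σ) :
    ∃ C > (0:ℝ), ∀ a b c : V3 → V3,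
      InSobV σ a → cNormV ((σ : ℝ) + 1/4) a ≠ ⊤ →
      InSobV (σ + 1) b → cNormV ((σ : ℝ) + 5/4) b ≠ ⊤ →
      InSobV σ c → (∀ x, vdiv a x = 0) →
      |sobInnerV σ (fun x => advect a b x) c| ≤
        C * sobNorm σ c *
          min ((cNormV ((σ : ℝ) + 1/4) a).toReal * Real.sqrt (gradSobSq σ b))
              (sobNorm σ a * (cNormV ((σ : ℝ) + 5/4) b).toReal) := by
  refine ⟨(∑ _j : Fin 3, ∑ k ∈ Finset.range (σ + 1), ∑ _α : Fin k → Fin 3, (3 * 2 ^ σ : ℝ)) + 1,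
    add_pos_of_nonneg_of_pos (Finset.sum_nonneg fun _ _ => Finset.sum_nonneg fun _ _ =>
      Finset.sum_nonneg fun _ _ => by positivity) one_pos, ?_⟩
  intro a b c ha hca hb hcb hc _
  have hs : 0 ≤ sobNorm σ c := Real.sqrt_nonneg _
  have hsa : 0 ≤ sobNorm σ a := Real.sqrt_nonneg _
  have hf1 : ⌊(σ : ℝ) + 1/4⌋₊ = σ := by
    rw [Nat.floor_eq_iff (by positivity)]; constructor <;> linarith
  have hf2 : ⌊(σ : ℝ) + 5/4⌋₊ = σ + 1 := by
    rw [Nat.floor_eq_iff (by positivity)]; push_cast; constructor <;> linarith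
  have hg : ∀ i, sobNorm σ (fun x j => pd i (fun y => b y j) x) ≤ Real.sqrt (gradSobSq σ b) :=
    fun i => Real.sqrt_le_sqrt (Finset.single_le_sum
      (f := fun i => sobNormSq σ (fun x j => pd i (fun y => b y j) x))
      (fun i _ => sobNormSq_nonneg _ _) (Finset.mem_univ i))
  have hcdA : ∀ i, ∀ k ≤ σ, ContDiff ℝ (k : WithTop ℕ∞) (fun x => a x i) :=
    fun i k hk => (ha i).1.of_le (by exact_mod_cast hk)
  have hcdB : ∀ i j, ∀ k ≤ σ, ContDiff ℝ (k : WithTop ℕ∞) (pd i (fun y => b y j)) :=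
    fun i j k hk => (hb.pd i j).1.of_le (by exact_mod_cast hk)
  have hfin : ∀ M, 0 ≤ M → (∀ i j, ∀ k ≤ σ, ∀ α : Fin k → Fin 3,
      eLpNorm (mder k α (fun x => a x i * pd i (fun y => b y j) x)) 2 volume
      ≤ 2 ^ k * ENNReal.ofReal M) → |sobInnerV σ (fun x => advect a b x) c| ≤
      ((∑ _j : Fin 3, ∑ k ∈ Finset.range (σ + 1), ∑ _α : Fin k → Fin 3, (3 * 2 ^ σ : ℝ)) + 1)
        * sobNorm σ c * M := by
    intro M hM0 hM
    refine (final_bound a b c ha hb hc M hM0 hM).trans ?_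
    have : 0 ≤ sobNorm σ c * M := by positivity
    rw [mul_assoc]
    linarith
  have hcases := min_choice ((cNormV ((σ : ℝ) + 1/4) a).toReal * Real.sqrt (gradSobSq σ b))
    (sobNorm σ a * (cNormV ((σ : ℝ) + 5/4) b).toReal)
  rcases hcases with h | h <;> rw [h] <;> apply hfin
  · positivity
  · intro i j k hk α
    rw [ENNReal.ofReal_mul ENNReal.toReal_nonneg, ENNReal.ofReal_toReal hca]
    refine leibniz _ _ k α _ _ (hcdA i k hk) (hcdB i j k hk) ?_ ?_
    · intro m hm β x
      exact c_term_le hf1 a i (hm.trans hk) β x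
    · intro m hm β
      exact (sob_term_le (hb.pd i) j (hm.trans hk) β).trans (ENNReal.ofReal_le_ofReal (hg i))
  · positivity
  · intro i j k hk α
    rw [ENNReal.ofReal_mul hsa, ENNReal.ofReal_toReal hcb]
    refine leibniz' _ _ k α _ _ (hcdA i k hk) (hcdB i j k hk) ?_ ?_
    · intro m hm β
      exact sob_term_le ha i (hm.trans hk) β
    · intro m hm β x
      have := c_term_le hf2 b j (k := m + 1) (by omega) (Fin.cons i β) x
      simpa [mder] using this

end
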